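/- For every graph G = ([n], E) and every i with 1 ≤ i ≤ α(G), there exists a polynomial c_i(q) ∈ Z[q] such that for every prime power q, c_i(q) equals the number of i-dimensional totally-isotropic subspaces of the graphical matrix space B_G ≤ Λ(n, q), and c_i(1) equals the number of size-i independent sets of G. -/

import Mathlib

open Matrix Polynomial

def elemAlt {F : Type} [Field F] {n : ℕ} (i j : Fin n) : Matrix (Fin n) (Fin n) F :=
  fun a b => if a = i ∧ b = j then 1 else if a = j ∧ b = i then -1 else 0

noncomputable def graphSpace {n : ℕ} (F : Type) [Field F] (G : SimpleGraph (Fin n)) :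
    Submodule F (Matrix (Fin n) (Fin n) F) :=
  Submodule.span F {M | ∃ i j, G.Adj i j ∧ M = elemAlt i j}

def IsTotallyIsotropic {F : Type} [Field F] {n : ℕ}
    (𝓑 : Submodule F (Matrix (Fin n) (Fin n) F)) (U : Submodule F (Fin n → F)) : Prop :=
  ∀ u ∈ U, ∀ v ∈ U, ∀ B ∈ 𝓑, u ⬝ᵥ B *ᵥ v = 0

noncomputable def fsPoly : ℕ → ℕ → Polynomial ℤ
  | 0, 0 => 1
  | 0, _ + 1 => 0
  | _ + 1, 0 => 0
  | n + 1, i + 1 => fsPoly n i + (X ^ (i + 1) - 1) * fsPoly n (i + 1)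

lemma fsPoly_eval_one (n i : ℕ) : (fsPoly n i).eval 1 = if n = i then 1 else 0 := by
  induction n generalizing i with
  | zero => cases i <;> simp [fsPoly]
  | succ n ih => cases i <;> simp [fsPoly, ih]

lemma finrank_prod_top {F W : Type} [Field F] [AddCommGroup W] [Module F W] [FiniteDimensional F W]
    (U : Submodule F W) :
    Module.finrank F (U.prod (⊤ : Submodule F F)) = Module.finrank F U + 1 := by
  let e : (U × F) →ₗ[F] (U.prod (⊤ : Submodule F F)) :=
    (U.subtype.prodMap LinearMap.id).codRestrict _ (by
      rintro ⟨x, y⟩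
      simp)
  have he : Function.Bijective e := by
    constructor
    · rintro ⟨x, y⟩ ⟨x', y'⟩ h
      have h' := congrArg Subtype.val h
      simp only [e, LinearMap.codRestrict_apply, LinearMap.prodMap_apply, Prod.mk.injEq] at h'
      exact Prod.ext (Subtype.ext h'.1) h'.2
    · rintro ⟨⟨x, y⟩, hx⟩
      exact ⟨(⟨x, (Submodule.mem_prod.1 hx).1⟩, y), rfl⟩
  rw [← (LinearEquiv.ofBijective e he).finrank_eq]
  simp

lemma finrank_graph {F W : Type} [Field F] [AddCommGroup W] [Module F W] 
    (f : W →ₗ.[F] F) :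
    Module.finrank F f.graph = Module.finrank F f.domain := by
  let e : f.domain →ₗ[F] f.graph :=
    (f.domain.subtype.prod f.toFun).codRestrict _ (fun x => f.mem_graph x)
  have he : Function.Bijective e := by
    constructor
    · intro x x' h
      have h' := congrArg Subtype.val h
      exact Subtype.ext (congrArg Prod.fst h')
    · rintro ⟨x, hx⟩
      obtain ⟨y, hy⟩ := f.mem_graph_iff'.1 hx
      exact ⟨y, Subtype.ext hy⟩
  rw [← (LinearEquiv.ofBijective e he).finrank_eq]

lemma card_nonzero_dual {F U : Type} [Field F] [Fintype F] [AddCommGroup U] [Module F U] [Finite U] :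
    (Nat.card {f : U →ₗ[F] F // f ≠ 0} : ℤ) = (Fintype.card F : ℤ) ^ Module.finrank F U - 1 := by
  classical
  have : FiniteDimensional F U := Module.Finite.of_finite
  have : Finite (U →ₗ[F] F) := Module.finite_of_finite F
  have := Fintype.ofFinite (U →ₗ[F] F)
  rw [Nat.card_eq_fintype_card, Fintype.card_subtype_compl, Fintype.card_subtype_eq,
    Module.card_eq_pow_finrank (K := F), Module.finrank_linearMap_self, Nat.cast_sub]
  · simp
  · exact Nat.one_le_pow _ _ Fintype.card_pos

lemma card_step {F W : Type} [Field F] [Fintype F] [AddCommGroup W] [Module F W] [Finite W]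
    (P : Submodule F W → Prop) (i : ℕ) :
    (Nat.card {U : Submodule F (W × F) //
      P (U.map (LinearMap.fst F W F)) ∧ (∃ u ∈ U, u.2 ≠ 0) ∧ Module.finrank F U = i + 1} : ℤ) =
    Nat.card {U : Submodule F W // P U ∧ Module.finrank F U = i} +
    ((Fintype.card F : ℤ) ^ (i + 1) - 1) *
      Nat.card {U : Submodule F W // P U ∧ Module.finrank F U = i + 1} := by
  classical
  have : FiniteDimensional F W := Module.Finite.of_finite
  let A := {U : Submodule F W // P U ∧ Module.finrank F U = i}
  let B := {U : Submodule F W // P U ∧ Module.finrank F U = i + 1}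
  let g : A ⊕ (Σ U : B, {f : U.1 →ₗ[F] F // f ≠ 0}) → {U : Submodule F (W × F) //
      P (U.map (LinearMap.fst F W F)) ∧ (∃ u ∈ U, u.2 ≠ 0) ∧ Module.finrank F U = i + 1} :=
    fun x => match x with
    | Sum.inl U => ⟨U.1.prod ⊤, by
        rw [Submodule.prod_map_fst]; exact U.2.1, ⟨(0, 1), by simp, by simp⟩, by
        rw [finrank_prod_top, U.2.2]⟩
    | Sum.inr y => ⟨LinearPMap.graph ⟨y.1.1, y.2.1⟩, by
        rw [LinearPMap.graph_map_fst_eq_domain]; exact y.1.2.1, by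
        obtain ⟨x, hx⟩ := DFunLike.ne_iff.1 y.2.2
        exact ⟨(x.1, y.2.1 x), LinearPMap.mem_graph ⟨y.1.1, y.2.1⟩ x, hx⟩, by
        rw [finrank_graph]; exact y.1.2.2⟩
  have hg : Function.Bijective g := by
    constructor
    · rintro (U | ⟨U, f⟩) (U' | ⟨U', f'⟩) h
      · have h' := congrArg (fun z => Submodule.map (LinearMap.fst F W F) z.1) h
        simp only [g, Submodule.prod_map_fst] at h'
        exact congrArg _ (Subtype.ext h')
      · have h' : U.1.prod ⊤ = LinearPMap.graph ⟨U'.1, f'.1⟩ := congrArg Subtype.val h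
        have h1 : ((0 : W), (1 : F)) ∈ LinearPMap.graph ⟨U'.1, f'.1⟩ := by
          rw [← h']; simp
        exact absurd (LinearPMap.graph_fst_eq_zero_snd _ h1 rfl) one_ne_zero
      · have h' : LinearPMap.graph ⟨U.1, f.1⟩ = U'.1.prod ⊤ := congrArg Subtype.val h
        have h1 : ((0 : W), (1 : F)) ∈ LinearPMap.graph ⟨U.1, f.1⟩ := by
          rw [h']; simp
        exact absurd (LinearPMap.graph_fst_eq_zero_snd _ h1 rfl) one_ne_zero
      · have h' : LinearPMap.graph ⟨U.1, f.1⟩ = LinearPMap.graph ⟨U'.1, f'.1⟩ :=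
          congrArg Subtype.val h
        have h2 := LinearPMap.eq_of_eq_graph h'
        obtain ⟨U, hU⟩ := U
        obtain ⟨U', hU'⟩ := U'
        obtain ⟨f, hf⟩ := f
        obtain ⟨f', hf'⟩ := f'
        simp only [LinearPMap.mk.injEq] at h2
        obtain ⟨rfl, h3⟩ := h2
        obtain rfl := eq_of_heq h3
        rfl
    · rintro ⟨U, hP, ⟨u, hu, hu2⟩, hr⟩
      by_cases h1 : ((0 : W), (1 : F)) ∈ U
      · have hU : (U.map (LinearMap.fst F W F)).prod ⊤ = U := by
          ext ⟨x, y⟩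
          simp only [Submodule.mem_prod, Submodule.mem_map, Submodule.mem_top, and_true]
          constructor
          · rintro ⟨⟨a, b⟩, hab, rfl⟩
            have := U.add_mem hab (U.smul_mem (y - b) h1)
            simpa using this
          · intro h
            exact ⟨_, h, rfl⟩
        refine ⟨Sum.inl ⟨U.map (LinearMap.fst F W F), hP, ?_⟩, Subtype.ext hU⟩
        have := finrank_prod_top (U.map (LinearMap.fst F W F))
        rw [hU, hr] at this
        omega
      · have hg : ∀ x ∈ U, x.1 = 0 → x.2 = 0 := by
          rintro ⟨x, y⟩ hx h0
          by_contra hy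
          apply h1
          simp only at h0 hy
          subst h0
          have := U.smul_mem y⁻¹ hx
          simpa [hy] using this
        have hU := U.toLinearPMap_graph_eq hg
        refine ⟨Sum.inr ⟨⟨U.toLinearPMap.domain, hP, ?_⟩, ⟨U.toLinearPMap.toFun, ?_⟩⟩,
          Subtype.ext hU⟩
        · rw [← finrank_graph, hU, hr]
        · intro h0
          rw [← hU] at hu
          obtain ⟨y, hy⟩ := (LinearPMap.mem_graph_iff' _).1 hu
          apply hu2
          rw [← hy]
          exact DFunLike.congr_fun h0 y
  have hfin : Finite (Submodule F W) := inferInstance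
  have hA : Finite A := inferInstance
  have hB : Finite B := inferInstance
  have := Fintype.ofFinite B
  have hD : ∀ U : B, Finite {f : U.1 →ₗ[F] F // f ≠ 0} := fun U => by
    have : Finite (U.1 →ₗ[F] F) := Module.finite_of_finite F
    infer_instance
  rw [← Nat.card_congr (Equiv.ofBijective g hg), Nat.card_sum, Nat.card_sigma]
  push_cast
  congr 1
  rw [Finset.sum_congr rfl (fun U _ => by rw [card_nonzero_dual, U.2.2])]
  rw [Finset.sum_const, Finset.card_univ, ← Nat.card_eq_fintype_card, nsmul_eq_mul, mul_comm]

/-- Full-support subspaces. -/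
def FullSupp {F V : Type} [Field F] (U : Submodule F (V → F)) : Prop :=
  ∀ v, ∃ u ∈ U, u v ≠ 0

lemma card_fullSupp_congr {F V V' : Type} [Field F] (e : V ≃ V') (i : ℕ) :
    Nat.card {U : Submodule F (V → F) // FullSupp U ∧ Module.finrank F U = i} =
    Nat.card {U : Submodule F (V' → F) // FullSupp U ∧ Module.finrank F U = i} := by
  let L : (V → F) ≃ₗ[F] (V' → F) := LinearEquiv.funCongrLeft F F e.symm
  refine Nat.card_congr ((Submodule.orderIsoMapComap L).toEquiv.subtypeEquiv ?_)
  intro U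
  have : Module.finrank F (U.map (L : (V → F) →ₗ[F] (V' → F))) = Module.finrank F U :=
    L.finrank_map_eq U
  refine and_congr ?_ ?_
  · constructor
    · intro h v
      obtain ⟨u, hu, hv⟩ := h (e.symm v)
      exact ⟨L u, Submodule.mem_map_of_mem hu, hv⟩
    · intro h v
      obtain ⟨u, ⟨w, hw, rfl⟩, hv⟩ := h (e v)
      refine ⟨w, hw, ?_⟩
      simpa [L, LinearEquiv.funCongrLeft] using hv
  · exact (Eq.congr_left this).symm

lemma card_fullSupp_fin (F : Type) [Field F] [Fintype F] (n i : ℕ) :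
    (Nat.card {U : Submodule F (Fin n → F) // FullSupp U ∧ Module.finrank F U = i} : ℤ) =
      (fsPoly n i).eval (Fintype.card F : ℤ) := by
  induction n generalizing i with
  | zero =>
    have h0 : ∀ U : Submodule F (Fin 0 → F), Module.finrank F U = 0 := fun U =>
      Module.finrank_zero_of_subsingleton
    cases i with
    | zero =>
      have : Unique {U : Submodule F (Fin 0 → F) // FullSupp U ∧ Module.finrank F U = 0} :=
        { default := ⟨⊥, fun v => v.elim0, h0 _⟩
          uniq := fun U => Subtype.ext (Subsingleton.elim _ _) }
      rw [Nat.card_unique]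
      simp [fsPoly]
    | succ i =>
      have : IsEmpty {U : Submodule F (Fin 0 → F) // FullSupp U ∧ Module.finrank F U = i + 1} :=
        ⟨fun U => by have := U.2.2; rw [h0] at this; omega⟩
      simp [fsPoly]
  | succ n ih =>
    cases i with
    | zero =>
      have : IsEmpty {U : Submodule F (Fin (n + 1) → F) // FullSupp U ∧ Module.finrank F U = 0} := by
        refine ⟨fun U => ?_⟩
        have h := U.2.2
        rw [Submodule.finrank_eq_zero] at h
        obtain ⟨u, hu, h2⟩ := U.2.1 0
        rw [h, Submodule.mem_bot] at hu
        simp [hu] at h2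
      rw [Nat.card_of_isEmpty]
      simp [fsPoly]
    | succ i =>
      let L : ((Fin n → F) × F) ≃ₗ[F] (Fin (n + 1) → F) :=
        { toFun := fun x => Fin.cons x.2 x.1
          invFun := fun y => (fun j => y j.succ, y 0)
          left_inv := fun x => by simp
          right_inv := fun y => by ext j; refine Fin.cases ?_ (fun j => ?_) j <;> simp
          map_add' := fun x y => by ext j; refine Fin.cases ?_ (fun j => ?_) j <;> simp
          map_smul' := fun x y => by ext j; refine Fin.cases ?_ (fun j => ?_) j <;> simp }
      have hs := card_step (F := F) (W := Fin n → F) FullSupp i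
      rw [ih, ih] at hs
      simp only [fsPoly, eval_add, eval_mul, eval_sub, eval_pow, eval_X, eval_one]
      rw [← hs]
      congr 1
      symm
      refine Nat.card_congr ((Submodule.orderIsoMapComap L).toEquiv.subtypeEquiv ?_)
      intro U
      have hfr : Module.finrank F (U.map (L : _ →ₗ[F] (Fin (n + 1) → F))) = Module.finrank F U :=
        L.finrank_map_eq U
      rw [← and_assoc]
      refine and_congr ?_ (Eq.congr_left hfr).symm
      constructor
      · rintro ⟨h1, u, hu, h2⟩ v
        refine Fin.cases ?_ (fun j => ?_) v
        · exact ⟨L u, Submodule.mem_map_of_mem hu, h2⟩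
        · obtain ⟨_, ⟨w, hw, rfl⟩, hv⟩ := h1 j
          exact ⟨L w, Submodule.mem_map_of_mem hw, by simpa [L] using hv⟩
      · intro h
        refine ⟨fun j => ?_, ?_⟩
        · obtain ⟨_, ⟨w, hw, rfl⟩, hv⟩ := h j.succ
          exact ⟨w.1, Submodule.mem_map_of_mem (f := LinearMap.fst F _ F) hw,
            by simpa [L] using hv⟩
        · obtain ⟨_, ⟨w, hw, rfl⟩, hv⟩ := h 0
          exact ⟨w, hw, by simpa [L] using hv⟩

lemma card_fullSupp (F V : Type) [Field F] [Fintype F] [Finite V] (i : ℕ) :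
    (Nat.card {U : Submodule F (V → F) // FullSupp U ∧ Module.finrank F U = i} : ℤ) =
      (fsPoly (Nat.card V) i).eval (Fintype.card F : ℤ) := by
  rw [card_fullSupp_congr (Finite.equivFin V), card_fullSupp_fin]

lemma isTotallyIsotropic_iff {F : Type} [Field F] {n : ℕ} (G : SimpleGraph (Fin n))
    (U : Submodule F (Fin n → F)) :
    IsTotallyIsotropic (graphSpace F G) U ↔
      ∀ u ∈ U, ∀ v ∈ U, ∀ a b, G.Adj a b → u a * v b = u b * v a := by
  have key : ∀ (u v : Fin n → F) (a b : Fin n), a ≠ b →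
      u ⬝ᵥ (elemAlt a b : Matrix (Fin n) (Fin n) F) *ᵥ v = u a * v b - u b * v a := by
    intro u v a b hab
    have : (elemAlt a b : Matrix (Fin n) (Fin n) F) =
        Matrix.single a b 1 - Matrix.single b a 1 := by
      ext x y
      simp only [elemAlt, Matrix.sub_apply, Matrix.single_apply]
      grind
    rw [this, Matrix.sub_mulVec, dotProduct_sub, Matrix.single_mulVec, Matrix.single_mulVec]
    simp [Function.update_apply, dotProduct]
  constructor
  · intro h u hu v hv a b hab
    have := h u hu v hv (elemAlt a b) (Submodule.subset_span ⟨a, b, hab, rfl⟩)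
    rw [key u v a b hab.ne] at this
    exact sub_eq_zero.1 this
  · intro h u hu v hv B hB
    induction hB using Submodule.span_induction with
    | mem M hM =>
      obtain ⟨a, b, hab, rfl⟩ := hM
      rw [key u v a b hab.ne, h u hu v hv a b hab, sub_self]
    | zero => simp
    | add x y _ _ hx hy => rw [Matrix.add_mulVec, dotProduct_add, hx, hy, add_zero]
    | smul c x _ hx => rw [Matrix.smul_mulVec, dotProduct_smul, hx, smul_zero]

/-- Connected components of the induced subgraph on `S`. -/
abbrev Comps {n : ℕ} (G : SimpleGraph (Fin n)) (S : Finset (Fin n)) : Type :=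
  (G.induce (S : Set (Fin n))).ConnectedComponent

/-- The component of a vertex. -/
abbrev cmk {n : ℕ} (G : SimpleGraph (Fin n)) (S : Finset (Fin n)) (s : (S : Set (Fin n))) :
    Comps G S := (G.induce (S : Set (Fin n))).connectedComponentMk s

/-- The chosen representative of a component. -/
noncomputable def crep {n : ℕ} (G : SimpleGraph (Fin n)) (S : Finset (Fin n)) (c : Comps G S) :
    (S : Set (Fin n)) := Quot.out c

lemma cmk_crep {n : ℕ} (G : SimpleGraph (Fin n)) (S : Finset (Fin n)) (c : Comps G S) :
    cmk G S (crep G S c) = c := Quot.out_eq c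

/-- Scalars on non-representative vertices. -/
abbrev Scal (F : Type) [Field F] {n : ℕ} (G : SimpleGraph (Fin n)) (S : Finset (Fin n)) : Type :=
  {s : (S : Set (Fin n)) // s ≠ crep G S (cmk G S s)} → Fˣ

open Classical in
/-- Extension of the scalars by one. -/
noncomputable def ext1 {F : Type} [Field F] {n : ℕ} {G : SimpleGraph (Fin n)}
    {S : Finset (Fin n)} (t : Scal F G S) (s : (S : Set (Fin n))) : Fˣ :=
  if h : s ≠ crep G S (cmk G S s) then t ⟨s, h⟩ else 1

open Classical in
/-- The embedding. -/
noncomputable def embL {F : Type} [Field F] {n : ℕ} {G : SimpleGraph (Fin n)}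
    {S : Finset (Fin n)} (t : Scal F G S) : (Comps G S → F) →ₗ[F] (Fin n → F) where
  toFun x v := if h : v ∈ S then (ext1 t ⟨v, h⟩ : F) * x (cmk G S ⟨v, h⟩) else 0
  map_add' x y := by
    ext v
    by_cases h : v ∈ S <;> simp [h, mul_add]
  map_smul' c x := by
    ext v
    by_cases h : v ∈ S <;> simp [h, mul_left_comm]

/-- Restriction to representatives. -/
noncomputable def resR (F : Type) [Field F] {n : ℕ} (G : SimpleGraph (Fin n))
    (S : Finset (Fin n)) : (Fin n → F) →ₗ[F] (Comps G S → F) where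
  toFun x c := x (crep G S c)
  map_add' x y := rfl
  map_smul' c x := rfl

lemma ext1_crep {F : Type} [Field F] {n : ℕ} {G : SimpleGraph (Fin n)}
    {S : Finset (Fin n)} (t : Scal F G S) (c : Comps G S) : ext1 t (crep G S c) = 1 := by
  unfold ext1
  rw [dif_neg]
  rw [cmk_crep]
  simp

lemma embL_apply {F : Type} [Field F] {n : ℕ} {G : SimpleGraph (Fin n)}
    {S : Finset (Fin n)} (t : Scal F G S) (x : Comps G S → F) (s : (S : Set (Fin n))) :
    embL t x s = (ext1 t s : F) * x (cmk G S s) := by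
  have h : (s : Fin n) ∈ S := s.2
  simp [embL, h]

lemma embL_apply_not {F : Type} [Field F] {n : ℕ} {G : SimpleGraph (Fin n)}
    {S : Finset (Fin n)} (t : Scal F G S) (x : Comps G S → F) {v : Fin n} (h : v ∉ S) :
    embL t x v = 0 := by
  simp [embL, h]

lemma resR_embL {F : Type} [Field F] {n : ℕ} {G : SimpleGraph (Fin n)}
    {S : Finset (Fin n)} (t : Scal F G S) (x : Comps G S → F) :
    resR F G S (embL t x) = x := by
  ext c
  change embL t x (crep G S c) = x c
  rw [embL_apply, ext1_crep, cmk_crep]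
  simp

lemma embL_inj {F : Type} [Field F] {n : ℕ} {G : SimpleGraph (Fin n)}
    {S : Finset (Fin n)} (t : Scal F G S) : Function.Injective (embL t) :=
  Function.LeftInverse.injective (resR_embL t)

lemma map_resR_embL {F : Type} [Field F] {n : ℕ} {G : SimpleGraph (Fin n)}
    {S : Finset (Fin n)} (t : Scal F G S) (U : Submodule F (Comps G S → F)) :
    (U.map (embL t)).map (resR F G S) = U := by
  rw [← Submodule.map_comp]
  have : (resR F G S).comp (embL t) = LinearMap.id := LinearMap.ext (resR_embL t)
  rw [this, Submodule.map_id]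

lemma finrank_map_embL {F : Type} [Field F] {n : ℕ} {G : SimpleGraph (Fin n)}
    {S : Finset (Fin n)} (t : Scal F G S) (U : Submodule F (Comps G S → F)) :
    Module.finrank F (U.map (embL t)) = Module.finrank F U :=
  (Submodule.equivMapOfInjective (embL t) (embL_inj t) U).finrank_eq.symm

lemma exists_scalar {F : Type} [Field F] {n : ℕ} {G : SimpleGraph (Fin n)}
    {S : Finset (Fin n)} {U : Submodule F (Fin n → F)}
    (hU : ∀ u ∈ U, ∀ v ∈ U, ∀ a b, G.Adj a b → u a * v b = u b * v a)
    (hS : ∀ v, v ∈ S ↔ ∃ u ∈ U, u v ≠ 0)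
    {a b : (S : Set (Fin n))} (h : (G.induce (S : Set (Fin n))).Reachable a b) :
    ∃ t : Fˣ, ∀ u ∈ U, u b = t * u a := by
  obtain ⟨p⟩ := h
  induction p with
  | nil => exact ⟨1, by simp⟩
  | @cons a b c hab p ih =>
    obtain ⟨t, ht⟩ := ih
    obtain ⟨w, hw, hwa⟩ := (hS a).1 a.2
    obtain ⟨z, hz, hzb⟩ := (hS b).1 b.2
    have hab' : G.Adj a b := hab
    have h1 : ∀ u ∈ U, u b = (w b / w a) * u a := by
      intro u hu
      have := hU u hu w hw a b hab'
      field_simp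
      linear_combination -this
    have h2 : w b / w a ≠ 0 := by
      intro h0
      apply hzb
      rw [h1 z hz, h0, zero_mul]
    refine ⟨t * Units.mk0 _ h2, fun u hu => ?_⟩
    rw [ht u hu, h1 u hu]
    simp [mul_assoc]

lemma card_fiber {n : ℕ} (G : SimpleGraph (Fin n)) (i : ℕ) (S : Finset (Fin n))
    (F : Type) [Field F] [Fintype F] :
    Nat.card {U : Submodule F (Fin n → F) //
      ((∀ u ∈ U, ∀ v ∈ U, ∀ a b, G.Adj a b → u a * v b = u b * v a) ∧ Module.finrank F U = i) ∧
        ∀ v, v ∈ S ↔ ∃ u ∈ U, u v ≠ 0} =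
    Nat.card {U : Submodule F (Comps G S → F) // FullSupp U ∧ Module.finrank F U = i} *
      Nat.card (Scal F G S) := by
  rw [← Nat.card_prod]
  symm
  let g : {U : Submodule F (Comps G S → F) // FullSupp U ∧ Module.finrank F U = i} × Scal F G S →
    {U : Submodule F (Fin n → F) //
      ((∀ u ∈ U, ∀ v ∈ U, ∀ a b, G.Adj a b → u a * v b = u b * v a) ∧ Module.finrank F U = i) ∧
        ∀ v, v ∈ S ↔ ∃ u ∈ U, u v ≠ 0} := fun x => ⟨x.1.1.map (embL x.2), by
      refine ⟨⟨?_, ?_⟩, ?_⟩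
      · rintro _ ⟨u, hu, rfl⟩ _ ⟨v, hv, rfl⟩ a b hab
        by_cases ha : a ∈ S
        · by_cases hb : b ∈ S
          · have h1 := fun y => embL_apply x.2 y ⟨a, ha⟩
            have h2 := fun y => embL_apply x.2 y ⟨b, hb⟩
            have h3 : cmk G S ⟨a, ha⟩ = cmk G S ⟨b, hb⟩ := by
              apply SimpleGraph.ConnectedComponent.sound
              apply SimpleGraph.Adj.reachable
              exact hab
            simp only at h1 h2
            rw [h1, h1, h2, h2, h3]
            ring
          · rw [embL_apply_not _ _ hb, embL_apply_not _ _ hb]; simp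
        · rw [embL_apply_not _ _ ha, embL_apply_not _ _ ha]; simp
      · rw [finrank_map_embL, x.1.2.2]
      · intro v
        constructor
        · intro hv
          obtain ⟨u, hu, h⟩ := x.1.2.1 (cmk G S ⟨v, hv⟩)
          refine ⟨embL x.2 u, Submodule.mem_map_of_mem hu, ?_⟩
          have h1 := embL_apply x.2 u ⟨v, hv⟩
          simp only at h1
          rw [h1]
          exact mul_ne_zero (Units.ne_zero _) h
        · rintro ⟨_, ⟨u, hu, rfl⟩, h⟩
          by_contra hv
          exact h (embL_apply_not _ _ hv)⟩
  refine Nat.card_congr (Equiv.ofBijective g ⟨?_, ?_⟩)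
  · rintro ⟨⟨U, hU⟩, t⟩ ⟨⟨U', hU'⟩, t'⟩ h
    have h' : U.map (embL t) = U'.map (embL t') := congrArg Subtype.val h
    have hUU : U = U' := by
      rw [← map_resR_embL t U, h', map_resR_embL]
    subst hUU
    have : t = t' := by
      funext s
      obtain ⟨x, hx, hx0⟩ := hU.1 (cmk G S s.1)
      have hm : embL t x ∈ U.map (embL t') := h' ▸ Submodule.mem_map_of_mem hx
      obtain ⟨y, hy, hxy⟩ := hm
      have hyx : y = x := by
        rw [← resR_embL t' y, hxy, resR_embL]
      subst hyx
      have h4 := congrFun hxy s.1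
      rw [embL_apply, embL_apply] at h4
      have h5 := mul_right_cancel₀ hx0 h4
      have h6 := Units.ext h5
      unfold ext1 at h6
      rw [dif_pos s.2, dif_pos s.2] at h6
      exact h6.symm
    rw [this]
  · rintro ⟨U, ⟨hU, hr⟩, hS⟩
    have hreach : ∀ s : (S : Set (Fin n)), ∃ t : Fˣ, ∀ u ∈ U,
        u s = t * u (crep G S (cmk G S s)) := by
      intro s
      apply exists_scalar hU hS
      apply SimpleGraph.ConnectedComponent.exact
      exact cmk_crep G S _
    choose t ht using hreach
    let t' : Scal F G S := fun s => t s.1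
    have hLR : ∀ u ∈ U, embL t' (resR F G S u) = u := by
      intro u hu
      ext v
      by_cases hv : v ∈ S
      · have h1 := embL_apply t' (resR F G S u) ⟨v, hv⟩
        simp only at h1
        rw [h1]
        change _ * u (crep G S _) = u v
        unfold ext1
        split_ifs with hh
        · exact (ht ⟨v, hv⟩ u hu).symm
        · rw [not_not] at hh
          rw [← hh]; simp
      · rw [embL_apply_not _ _ hv]
        by_contra h
        exact hv ((hS v).2 ⟨u, hu, Ne.symm h⟩)
    have hmap : (U.map (resR F G S)).map (embL t') = U := by
      ext x
      constructor
      · rintro ⟨_, ⟨u, hu, rfl⟩, rfl⟩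
        rw [hLR u hu]; exact hu
      · intro hx
        exact ⟨_, ⟨x, hx, rfl⟩, hLR x hx⟩
    refine ⟨(⟨U.map (resR F G S), ?_, ?_⟩, t'), Subtype.ext hmap⟩
    · intro c
      obtain ⟨u, hu, h⟩ := (hS (crep G S c)).1 (crep G S c).2
      exact ⟨_, Submodule.mem_map_of_mem hu, h⟩
    · rw [← finrank_map_embL t', hmap, hr]

lemma card_rep {n : ℕ} (G : SimpleGraph (Fin n)) (S : Finset (Fin n)) :
    Nat.card {s : (S : Set (Fin n)) // s ≠ crep G S (cmk G S s)} =
      S.card - Nat.card (Comps G S) := by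
  classical
  have h1 : Nat.card {s : (S : Set (Fin n)) // s = crep G S (cmk G S s)} =
      Nat.card (Comps G S) :=
    Nat.card_congr
      { toFun := fun s => cmk G S s.1
        invFun := fun c => ⟨crep G S c, by rw [cmk_crep]⟩
        left_inv := fun s => Subtype.ext s.2.symm
        right_inv := fun c => cmk_crep G S c }
  rw [← h1, Nat.card_eq_fintype_card, Nat.card_eq_fintype_card, Fintype.card_subtype_compl]
  simp

lemma card_scal {n : ℕ} (G : SimpleGraph (Fin n)) (S : Finset (Fin n))
    (F : Type) [Field F] [Fintype F] :
    (Nat.card (Scal F G S) : ℤ) = ((Fintype.card F : ℤ) - 1) ^ (S.card - Nat.card (Comps G S)) := by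
  classical
  rw [Nat.card_fun, card_rep, Nat.card_units, Nat.card_eq_fintype_card, Nat.cast_pow,
    Nat.cast_sub Fintype.card_pos]
  simp

lemma card_comps_le {n : ℕ} (G : SimpleGraph (Fin n)) (S : Finset (Fin n)) :
    Nat.card (Comps G S) ≤ S.card := by
  have := Nat.card_le_card_of_surjective (cmk G S) (fun c => ⟨_, cmk_crep G S c⟩)
  simpa using this

lemma card_comps_eq_iff {n : ℕ} (G : SimpleGraph (Fin n)) (S : Finset (Fin n)) :
    Nat.card (Comps G S) = S.card ↔ ∀ u ∈ S, ∀ v ∈ S, ¬G.Adj u v := by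
  have hs : Function.Surjective (cmk G S) := fun c => ⟨_, cmk_crep G S c⟩
  have hc : Nat.card (S : Set (Fin n)) = S.card := by simp
  constructor
  · intro h u hu v hv huv
    have hb : Function.Bijective (cmk G S) :=
      (Nat.bijective_iff_surjective_and_card _).2 ⟨hs, by rw [hc, h]⟩
    have : cmk G S ⟨u, hu⟩ = cmk G S ⟨v, hv⟩ := by
      apply SimpleGraph.ConnectedComponent.sound
      apply SimpleGraph.Adj.reachable
      exact huv
    have := hb.1 this
    simp only [Subtype.mk.injEq] at this
    exact huv.ne this
  · intro h
    rw [← hc]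
    symm
    refine Nat.card_eq_of_bijective (cmk G S) ⟨?_, hs⟩
    intro a b hab
    obtain ⟨p⟩ := SimpleGraph.ConnectedComponent.exact hab
    cases p with
    | nil => rfl
    | cons hadj p => exact absurd hadj (h _ a.2 _ (Subtype.coe_prop _))

/-- For a graph `G` on `[n]` and `1 ≤ i ≤ α(G)`, there is a polynomial `c_i ∈ ℤ[q]`
whose value at every prime power `q` (i.e. at the order of every finite field `F`) is
the number of `i`-dimensional totally-isotropic subspaces of the graphical matrix space
`B_G ≤ Λ(n, q)`, and whose value at `q = 1` is the number of size-`i` independent sets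
of `G`. -/
theorem exists_counting_polynomial {n : ℕ} (G : SimpleGraph (Fin n)) (i : ℕ) (hi : 1 ≤ i)
    (halpha : ∃ S : Finset (Fin n), S.card = i ∧ ∀ u ∈ S, ∀ v ∈ S, ¬G.Adj u v) :
    ∃ c : Polynomial ℤ,
      (∀ (F : Type) [Field F] [Fintype F],
        c.eval (Fintype.card F : ℤ) =
          (Nat.card {U : Submodule F (Fin n → F) //
            IsTotallyIsotropic (graphSpace F G) U ∧ Module.finrank F U = i} : ℤ)) ∧
      c.eval 1 =
        (Nat.card {S : Finset (Fin n) //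
          S.card = i ∧ ∀ u ∈ S, ∀ v ∈ S, ¬G.Adj u v} : ℤ) := by
  classical
  refine ⟨∑ S : Finset (Fin n), fsPoly (Nat.card (Comps G S)) i *
    (X - 1) ^ (S.card - Nat.card (Comps G S)), ?_, ?_⟩
  · intro F _ _
    rw [eval_finsetSum]
    have hsum : ∀ S : Finset (Fin n), eval (Fintype.card F : ℤ)
        (fsPoly (Nat.card (Comps G S)) i * (X - 1) ^ (S.card - Nat.card (Comps G S))) =
        (Nat.card {U : Submodule F (Fin n → F) //
          ((∀ u ∈ U, ∀ v ∈ U, ∀ a b, G.Adj a b → u a * v b = u b * v a) ∧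
            Module.finrank F U = i) ∧ ∀ v, v ∈ S ↔ ∃ u ∈ U, u v ≠ 0} : ℤ) := by
      intro S
      rw [card_fiber, Nat.cast_mul, card_fullSupp, card_scal]
      simp
    rw [Finset.sum_congr rfl (fun S _ => hsum S), ← Nat.cast_sum, ← Nat.card_sigma]
    congr 1
    refine Nat.card_congr
      { toFun := fun x => ⟨x.2.1, (isTotallyIsotropic_iff G _).2 x.2.2.1.1, x.2.2.1.2⟩
        invFun := fun U => ⟨Finset.univ.filter (fun v => ∃ u ∈ U.1, u v ≠ 0), U.1,
          ⟨(isTotallyIsotropic_iff G _).1 U.2.1, U.2.2⟩, fun v => by simp⟩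
        left_inv := ?_
        right_inv := fun U => rfl }
    rintro ⟨S, U, hU, hS⟩
    have hSS : Finset.univ.filter (fun v => ∃ u ∈ U, u v ≠ 0) = S := by
      ext v
      simp [hS v]
    subst hSS
    rfl
  · rw [eval_finsetSum, Nat.card_eq_fintype_card, Fintype.card_subtype, Finset.card_filter,
      Nat.cast_sum]
    refine Finset.sum_congr rfl (fun S _ => ?_)
    have hle := card_comps_le G S
    have hiff := card_comps_eq_iff G S
    simp only [eval_mul, eval_pow, eval_sub, eval_X, eval_one, sub_self, fsPoly_eval_one]
    by_cases hc : Nat.card (Comps G S) = S.card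
    · have hind := hiff.1 hc
      rw [hc]
      by_cases hS : S.card = i
      · rw [if_pos hS, if_pos ⟨hS, hind⟩]; simp
      · rw [if_neg hS, if_neg (fun h => hS h.1)]; simp
    · have hne : S.card - Nat.card (Comps G S) ≠ 0 := by omega
      rw [zero_pow hne, mul_zero, if_neg (fun h => hc (hiff.2 h.2))]
      simp
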